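/- Let G be a finite group, H ≤ G with |G:H| = n, and χ ∈ Irr(G) with χ_H irreducible. If the number of ψ ∈ Irr(G) whose restriction to H has χ_H as a constituent equals n, then every such ψ satisfies ψ(1) = χ(1) and (χ_H)^G is the sum of these n distinct irreducible characters, each with multiplicity one. -/

import Mathlib

open CategoryTheory

attribute [local instance] Fintype.ofFinite
attribute [local instance] Classical.propDecidable

/-- The usual inner product of class functions on a finite group. -/
noncomputable def charInner (G : Type) [Group G] [Fintype G] (φ ψ : G → ℂ) : ℂ :=
  (Fintype.card G : ℂ)⁻¹ * ∑ g : G, φ g * (starRingEnd ℂ) (ψ g)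

/-- `χ` is an irreducible (complex) character of `G`. -/
def IsIrrChar (G : Type) [Group G] (χ : G → ℂ) : Prop :=
  ∃ V : FDRep ℂ G, Simple V ∧ (FDRep.character V : G → ℂ) = χ

/-- The character of `G` induced from the class function `θ` on `H`. -/
noncomputable def indChar (G : Type) [Group G] [Fintype G] (H : Subgroup G)
    (θ : H → ℂ) : G → ℂ :=
  fun g => (Nat.card H : ℂ)⁻¹ *
    ∑ x : G, if h : x * g * x⁻¹ ∈ H then θ ⟨x * g * x⁻¹, h⟩ else 0

section CharInner

open scoped ComplexConjugate

variable {G : Type} [Group G] [Fintype G]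

theorem charInner_sub_left (φ₁ φ₂ ψ : G → ℂ) :
    charInner G (φ₁ - φ₂) ψ = charInner G φ₁ ψ - charInner G φ₂ ψ := by
  simp [charInner, sub_mul, mul_sub]

theorem charInner_sub_right (φ ψ₁ ψ₂ : G → ℂ) :
    charInner G φ (ψ₁ - ψ₂) = charInner G φ ψ₁ - charInner G φ ψ₂ := by
  simp [charInner, mul_sub]

theorem charInner_sum_left (S : Finset (G → ℂ)) (ψ : G → ℂ) :
    charInner G (∑ φ ∈ S, φ) ψ = ∑ φ ∈ S, charInner G φ ψ := by
  simp only [charInner, Finset.sum_apply, Finset.sum_mul, ← Finset.mul_sum]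
  rw [Finset.sum_comm]

theorem charInner_conj_symm (φ ψ : G → ℂ) : conj (charInner G φ ψ) = charInner G ψ φ := by
  simp [charInner, mul_comm]

theorem charInner_sum_right (S : Finset (G → ℂ)) (φ : G → ℂ) :
    charInner G φ (∑ ψ ∈ S, ψ) = ∑ ψ ∈ S, charInner G φ ψ := by
  rw [← charInner_conj_symm, charInner_sum_left, map_sum]
  simp_rw [charInner_conj_symm]

theorem charInner_self (φ : G → ℂ) :
    charInner G φ φ = (((Fintype.card G : ℝ)⁻¹ * ∑ g, ‖φ g‖ ^ 2 : ℝ) : ℂ) := by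
  simp [charInner, Complex.mul_conj']

theorem eq_zero_of_charInner_self_re_nonpos {φ : G → ℂ} (h : (charInner G φ φ).re ≤ 0) :
    φ = 0 := by
  rw [charInner_self, Complex.ofReal_re] at h
  have hpos : (0 : ℝ) < (Fintype.card G : ℝ)⁻¹ := by simp [Fintype.card_pos]
  have hsum : ∑ g, ‖φ g‖ ^ 2 = 0 :=
    le_antisymm (nonpos_of_mul_nonpos_right h hpos) (by positivity)
  ext g
  simpa using (Finset.sum_eq_zero_iff_of_nonneg (fun _ _ => by positivity)).1 hsum g
    (Finset.mem_univ g)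

end CharInner

section Characters

open scoped ComplexConjugate ComplexOrder MatrixOrder

variable {G : Type} [Group G]

theorem FDRep.finrank_le_of_simple_of_hom_ne_zero {V W : FDRep ℂ G} [Simple V] {f : V ⟶ W}
    (hf : f ≠ 0) : Module.finrank ℂ V ≤ Module.finrank ℂ W := by
  have : Mono f := mono_of_nonzero_from_simple hf
  have hinj : Function.Injective ((forget₂ (FDRep ℂ G) (Rep ℂ G)).map f) :=
    (Rep.mono_iff_injective _).1 inferInstance
  exact LinearMap.finrank_le_finrank_of_injective (f := f.hom.hom.hom) hinj

theorem IsIrrChar.conj_mul {χ : G → ℂ} (hχ : IsIrrChar G χ) (x g : G) :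
    χ (x * g * x⁻¹) = χ g := by
  obtain ⟨V, _, rfl⟩ := hχ
  exact FDRep.char_conj V g x

theorem IsIrrChar.exists_restrict {ψ : G → ℂ} (hψ : IsIrrChar G ψ) (H : Subgroup G) :
    ∃ V : FDRep ℂ H, V.character = fun h : H => ψ h := by
  obtain ⟨V, _, rfl⟩ := hψ
  exact ⟨FDRep.of (V.ρ.comp H.subtype), rfl⟩

variable [Fintype G]

/-- Averaging a positive definite form makes a representation by matrices unitary. -/
theorem Matrix.trace_inv_eq_conj_trace {n : Type} [Fintype n] [DecidableEq n]
    (ρ : G →* Matrix n n ℂ) (g : G) : (ρ g⁻¹).trace = conj (ρ g).trace := by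
  let P : Matrix n n ℂ := ∑ x, (ρ x).conjTranspose * ρ x
  have hP : IsUnit P := by
    have hone : (1 : Matrix n n ℂ).PosDef := Matrix.PosDef.one
    have h := hone.add_posSemidef (Matrix.posSemidef_sum (Finset.univ.erase (1 : G))
      fun x _ => Matrix.posSemidef_conjTranspose_mul_self (ρ x))
    have hPeq : P = 1 + ∑ x ∈ Finset.univ.erase (1 : G), (ρ x).conjTranspose * ρ x := by
      simp only [P]
      rw [← Finset.add_sum_erase _ _ (Finset.mem_univ (1 : G))]
      simp
    exact hPeq ▸ h.isUnit
  have hinv : (ρ g).conjTranspose * P = P * ρ g⁻¹ := by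
    simp only [P, Finset.mul_sum, Finset.sum_mul]
    refine Fintype.sum_equiv (Equiv.mulRight g) _ _ fun x => ?_
    rw [Equiv.coe_mulRight, mul_assoc, ← map_mul ρ (x * g), mul_inv_cancel_right, map_mul,
      Matrix.conjTranspose_mul, mul_assoc]
  have hdet : IsUnit P.det := (Matrix.isUnit_iff_isUnit_det P).1 hP
  have hconj : ρ g⁻¹ = P⁻¹ * ((ρ g).conjTranspose * P) := by
    rw [hinv, ← mul_assoc, Matrix.nonsing_inv_mul _ hdet, one_mul]
  rw [hconj, Matrix.trace_mul_comm, mul_assoc, Matrix.mul_nonsing_inv _ hdet, mul_one,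
    Matrix.trace_conjTranspose]
  rfl

theorem FDRep.char_inv_eq_conj (V : FDRep ℂ G) (g : G) :
    V.character g⁻¹ = conj (V.character g) := by
  let b := Module.finBasis ℂ V
  simp only [FDRep.character, LinearMap.trace_eq_matrix_trace ℂ b]
  exact Matrix.trace_inv_eq_conj_trace
      ((LinearMap.toMatrixAlgEquiv b : (V →ₗ[ℂ] V) ≃ₐ[ℂ] _).toMulEquiv.toMonoidHom.comp V.ρ) g

theorem charInner_character (V W : FDRep ℂ G) :
    charInner G W.character V.character = Module.finrank ℂ (V ⟶ W) := by
  let _ : Invertible (Nat.card G : ℂ) := invertibleOfNonzero (by simp)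
  rw [← FDRep.scalar_product_char_eq_finrank_equivariant]
  simp [charInner, FDRep.char_inv_eq_conj]

theorem IsIrrChar.charInner_eq {φ ψ : G → ℂ} (hφ : IsIrrChar G φ) (hψ : IsIrrChar G ψ) :
    charInner G φ ψ = if φ = ψ then 1 else 0 := by
  obtain ⟨V, _, rfl⟩ := hφ
  obtain ⟨W, _, rfl⟩ := hψ
  rw [charInner_character, FDRep.finrank_hom_simple_simple]
  by_cases h : Nonempty (W ≅ V)
  · simp [h, FDRep.char_iso h.some]
  · have hne : V.character ≠ W.character := by
      intro heq
      have h₁ := charInner_character W V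
      have h₂ := charInner_character W W
      rw [FDRep.finrank_hom_simple_simple] at h₁ h₂
      rw [heq, h₂] at h₁
      simp [h] at h₁
    simp [h, hne]

end Characters

section Induction

open scoped ComplexConjugate

variable {G : Type} [Group G] [Fintype G] (H : Subgroup G)

theorem charInner_indChar (θ : H → ℂ) {ψ : G → ℂ} (hψ : ∀ x g, ψ (x * g * x⁻¹) = ψ g) :
    charInner G (indChar G H θ) ψ = charInner H θ fun h : H => ψ h := by
  have key : ∀ x : G, (∑ g : G, (if h : x * g * x⁻¹ ∈ H then θ ⟨x * g * x⁻¹, h⟩ else 0) *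
      conj (ψ g)) = ∑ h : H, θ h * conj (ψ h) := by
    intro x
    refine (Fintype.sum_of_injective (fun h : H => x⁻¹ * h * x) (fun a b hab => ?_) _ _
      (fun g hg => ?_) fun h => ?_).symm
    · simpa using hab
    · have hmem : x * g * x⁻¹ ∉ H := fun hmem => hg ⟨⟨_, hmem⟩, by simp [mul_assoc]⟩
      simp [hmem]
    · have hx : x * (x⁻¹ * h * x) * x⁻¹ = h := by group
      rw [← hψ x (x⁻¹ * h * x)]
      simp only [hx, h.2, dif_pos, Subtype.coe_eta]
  have hG : (Fintype.card G : ℂ) ≠ 0 := by simp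
  simp only [charInner, indChar, mul_assoc (Nat.card H : ℂ)⁻¹, Finset.sum_mul, ← Finset.mul_sum]
  rw [Finset.sum_comm]
  simp only [key, Finset.sum_const, Finset.card_univ, nsmul_eq_mul]
  rw [mul_left_comm, inv_mul_cancel_left₀ hG, Nat.card_eq_fintype_card]

theorem indChar_conj_mul (θ : H → ℂ) (x g : G) :
    indChar G H θ (x * g * x⁻¹) = indChar G H θ g := by
  simp only [indChar]
  congr 1
  refine Fintype.sum_equiv (Equiv.mulRight x) _ _ fun y => ?_
  simp [mul_assoc]

/-- Inducing the restriction of a class function multiplies it by the permutation character. -/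
theorem indChar_restrict {χ : G → ℂ} (hχ : ∀ x g, χ (x * g * x⁻¹) = χ g) (g : G) :
    indChar G H (fun h : H => χ h) g =
      (((Nat.card H : ℝ)⁻¹ * (Finset.univ.filter fun x : G => x * g * x⁻¹ ∈ H).card : ℝ) : ℂ) *
        χ g := by
  simp only [indChar, hχ, dite_eq_ite, ← Finset.sum_filter, Finset.sum_const, nsmul_eq_mul]
  push_cast
  ring

theorem inv_card_mul_card_eq_index : (Nat.card H : ℝ)⁻¹ * Fintype.card G = H.index := by
  rw [← Nat.card_eq_fintype_card, ← H.card_mul_index]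
  push_cast
  exact inv_mul_cancel_left₀ (by simp) _

theorem indChar_restrict_one {χ : G → ℂ} (hχ : ∀ x g, χ (x * g * x⁻¹) = χ g) :
    indChar G H (fun h : H => χ h) 1 = H.index * χ 1 := by
  rw [indChar_restrict H hχ, ← Complex.ofReal_natCast H.index, ← inv_card_mul_card_eq_index]
  simp

theorem charInner_indChar_restrict_self_re_le {χ : G → ℂ}
    (hχ : ∀ x g, χ (x * g * x⁻¹) = χ g) :
    (charInner G (indChar G H fun h : H => χ h) (indChar G H fun h : H => χ h)).re ≤
      H.index * (charInner H (fun h : H => χ h) (fun h : H => χ h)).re := by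
  rw [charInner_indChar H _ (indChar_conj_mul H _), charInner_self, Complex.ofReal_re,
    mul_left_comm, Finset.mul_sum]
  have hre : ∀ h : H, (χ h * conj (indChar G H (fun h : H => χ h) h)).re =
      ((Nat.card H : ℝ)⁻¹ * (Finset.univ.filter fun x : G => x * h * x⁻¹ ∈ H).card) *
        ‖χ h‖ ^ 2 := by
    intro h
    rw [indChar_restrict H hχ, map_mul, Complex.conj_ofReal, mul_left_comm, Complex.mul_conj',
      ← Complex.ofReal_pow, ← Complex.ofReal_mul, Complex.ofReal_re]
  rw [charInner, ← Complex.ofReal_natCast, ← Complex.ofReal_inv, Complex.re_ofReal_mul,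
    Complex.re_sum]
  simp only [hre]
  gcongr with h
  rw [← inv_card_mul_card_eq_index]
  gcongr
  exact Finset.card_le_univ _

end Induction

/-- If `χ ∈ Irr(G)` restricts irreducibly to `H`, `|G:H| = n`, and there are exactly `n`
irreducible characters `ψ` of `G` whose restriction to `H` has `χ_H` as a constituent,
then each such `ψ` has `ψ(1) = χ(1)` and `(χ_H)^G` is the sum of these `n` distinct
irreducible characters, each with multiplicity one. -/
theorem stmt7 (G : Type) [Group G] [Fintype G] (H : Subgroup G) (n : ℕ)
    (hn : H.index = n) (χ : G → ℂ) (hχ : IsIrrChar G χ)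
    (hres : IsIrrChar H (fun h : H => χ h))
    (S : Finset (G → ℂ))
    (hS : ∀ ψ : G → ℂ, ψ ∈ S ↔ (IsIrrChar G ψ ∧
        charInner H (fun h : H => ψ h) (fun h : H => χ h) ≠ 0))
    (hcard : S.card = n) :
    (∀ ψ ∈ S, ψ 1 = χ 1) ∧
      indChar G H (fun h : H => χ h) = fun g => ∑ ψ ∈ S, ψ g := by
  subst hn
  have hclass := hχ.conj_mul
  have hmult : ∀ ψ ∈ S, ∃ m : ℕ, 1 ≤ m ∧
      charInner H (fun h : H => ψ h) (fun h : H => χ h) = m := by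
    intro ψ hψ
    obtain ⟨hirr, hne⟩ := (hS ψ).1 hψ
    obtain ⟨V, hV⟩ := hirr.exists_restrict H
    obtain ⟨W, _, hW⟩ := hres
    rw [← hV, ← hW, charInner_character] at hne ⊢
    exact ⟨_, Nat.one_le_iff_ne_zero.2 (by exact_mod_cast hne), rfl⟩
  have hF : indChar G H (fun h : H => χ h) = ∑ ψ ∈ S, ψ := by
    refine sub_eq_zero.1 (eq_zero_of_charInner_self_re_nonpos ?_)
    set f := indChar G H fun h : H => χ h with hf
    have hff : (charInner G f f).re ≤ S.card := by
      simpa [hres.charInner_eq hres, hcard] using charInner_indChar_restrict_self_re_le H hclass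
    have hSf : (S.card : ℝ) ≤ (charInner G (∑ ψ ∈ S, ψ) f).re := by
      rw [charInner_sum_left, Complex.re_sum, Finset.card_eq_sum_ones, Nat.cast_sum]
      refine Finset.sum_le_sum fun ψ hψ => ?_
      obtain ⟨m, hm, hmeq⟩ := hmult ψ hψ
      rw [← charInner_conj_symm, hf, charInner_indChar H _ ((hS ψ).1 hψ).1.conj_mul,
        charInner_conj_symm, hmeq]
      simpa using hm
    have hfS : (charInner G f (∑ ψ ∈ S, ψ)).re = (charInner G (∑ ψ ∈ S, ψ) f).re := by
      rw [← charInner_conj_symm, Complex.conj_re]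
    have hSS : charInner G (∑ ψ ∈ S, ψ) (∑ ψ ∈ S, ψ) = S.card := by
      rw [charInner_sum_left, Finset.card_eq_sum_ones, Nat.cast_sum]
      refine Finset.sum_congr rfl fun ψ hψ => ?_
      rw [charInner_sum_right, Finset.sum_congr rfl fun φ hφ =>
        ((hS ψ).1 hψ).1.charInner_eq ((hS φ).1 hφ).1]
      simp [hψ]
    rw [charInner_sub_left, charInner_sub_right, charInner_sub_right, hSS]
    simp only [Complex.sub_re, Complex.natCast_re]
    linarith
  refine ⟨?_, by rw [hF]; ext g; simp⟩
  have hdeg : ∀ ψ ∈ S, (χ 1).re ≤ (ψ 1).re ∧ (ψ 1).im = (χ 1).im := by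
    intro ψ hψ
    obtain ⟨hirr, hne⟩ := (hS ψ).1 hψ
    obtain ⟨V, hV⟩ := hirr.exists_restrict H
    obtain ⟨W, _, hW⟩ := hres
    rw [← hV, ← hW, charInner_character] at hne
    have hnt : Nontrivial (W ⟶ V) := Module.nontrivial_of_finrank_pos (R := ℂ)
      (Nat.pos_of_ne_zero (by exact_mod_cast hne))
    obtain ⟨f, hf⟩ := exists_ne (0 : W ⟶ V)
    have hψ1 : ψ 1 = Module.finrank ℂ V := by rw [← FDRep.char_one, hV]; simp
    have hχ1 : χ 1 = Module.finrank ℂ W := by rw [← FDRep.char_one, hW]; simp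
    rw [hψ1, hχ1]
    exact ⟨by simpa using FDRep.finrank_le_of_simple_of_hom_ne_zero hf, by simp⟩
  have hsum : ∑ ψ ∈ S, (χ 1).re = ∑ ψ ∈ S, (ψ 1).re := by
    have h1 := congrArg Complex.re (congrFun hF 1)
    rw [indChar_restrict_one H hclass, Finset.sum_apply, Complex.re_sum] at h1
    rw [← h1, ← hcard]
    simp
  intro ψ hψ
  exact Complex.ext ((Finset.sum_eq_sum_iff_of_le fun φ hφ => (hdeg φ hφ).1).1 hsum ψ hψ).symm
    (hdeg ψ hψ).2
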